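/- Let n be a positive integer and ω = (1,2,...,n,-1,-2,...,-n) ∈ W_n. For every π ∈ NC^B(n): (1) ι(π) · ι(Kr(π)) = ω; and (2) |ι(π)|_B + |ι(Kr(π))|_B = |ω|_B = n, where |·|_B is the word-length in W_n with respect to R_n. Consequently ι(π) ∈ [ε, ω]. -/

import Mathlib

open scoped Classical

namespace NCPB

/-- A collection of subsets of `α` is a partition: blocks are nonempty and
every element lies in exactly one block. -/
def IsPartition {α : Type*} (P : Set (Set α)) : Prop :=
  (∀ B ∈ P, B.Nonempty) ∧ ∀ a : α, ∃! B, B ∈ P ∧ a ∈ B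

/-- The non-crossing condition for a collection of subsets of a linear order:
if `a < b < c < d`, `a, c` lie in a block `B` and `b, d` lie in a block `C`,
then `b ∈ B` (i.e. the blocks coincide). -/
def IsNC {α : Type*} [LinearOrder α] (P : Set (Set α)) : Prop :=
  ∀ B ∈ P, ∀ C ∈ P, ∀ a b c d : α, a < b → b < c → c < d →
    a ∈ B → c ∈ B → b ∈ C → d ∈ C → b ∈ B

/-- A non-crossing partition of a linear order. -/
def NCPart {α : Type*} [LinearOrder α] (P : Set (Set α)) : Prop :=
  IsPartition P ∧ IsNC P

/-- The set `[±m] = {1 < 2 < ... < m < -1 < -2 < ... < -m}` is encoded as `Fin (2*m)`,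
position `k < m` encoding `k+1` and position `m + j` encoding `-(j+1)`.
`negMap` is the inversion map `a ↦ -a`. -/
def negMap (m : ℕ) (k : Fin (2*m)) : Fin (2*m) :=
  ⟨(k.val + m) % (2*m), Nat.mod_lt _ (Nat.lt_of_le_of_lt (Nat.zero_le _) k.isLt)⟩

/-- Image of a subset of `[±m]` under the inversion map, i.e. `X ↦ -X`. -/
def negSet (m : ℕ) (X : Set (Fin (2*m))) : Set (Fin (2*m)) := negMap m '' X

/-- The absolute value map `[±m] → {1,...,m}`, `±i ↦ i`. -/
def absMap (m : ℕ) (k : Fin (2*m)) : Fin m :=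
  ⟨k.val % m, Nat.mod_lt _ (by have := k.isLt; omega)⟩

/-- A non-crossing partition of type B: a non-crossing partition of `[±m]`
invariant under the inversion map. -/
def NCBPart (m : ℕ) (π : Set (Set (Fin (2*m)))) : Prop :=
  NCPart π ∧ ∀ B ∈ π, negSet m B ∈ π

/-- The collection of sets `Abs(X)`, `X` a block of `π`. -/
def absPart (m : ℕ) (π : Set (Set (Fin (2*m)))) : Set (Set (Fin m)) :=
  {F | ∃ X ∈ π, F = absMap m '' X}

/-- The embedding of `{1,...,m}` onto the odd-indexed positions of the interleaved
set `1 < 1̄ < 2 < 2̄ < ... < m < m̄` (encoded as `Fin (2*m)`): `i ↦ i` (even positions). -/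
def evens (m : ℕ) (i : Fin m) : Fin (2*m) := ⟨2*i.val, by have := i.isLt; omega⟩

/-- The embedding of the barred copy `{1̄,...,m̄}` into the interleaved set: odd positions. -/
def odds (m : ℕ) (i : Fin m) : Fin (2*m) := ⟨2*i.val+1, by have := i.isLt; omega⟩

/-- `P` refines... rather: every block of `P` is contained in a block of `Q`
(the partial order on partitions by reverse refinement: `P ≤ Q`). -/
def Refines {α : Type*} (P Q : Set (Set α)) : Prop := ∀ B ∈ P, ∃ C ∈ Q, B ⊆ C

/-- The collection `p ∪ q̄` of subsets of the interleaved set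
`1 < 1̄ < 2 < 2̄ < ... < m < m̄`, with `p` living on the unbarred copy and `q` on the
barred copy. -/
def interleave (m : ℕ) (p q : Set (Set (Fin m))) : Set (Set (Fin (2*m))) :=
  ((fun B => evens m '' B) '' p) ∪ ((fun B => odds m '' B) '' q)

/-- `q` is the Kreweras complement of `p`: `q` is the largest non-crossing partition
(in the reverse-refinement order) such that `p ∪ q̄` is a non-crossing partition of the
interleaved set `1 < 1̄ < ... < m < m̄`. -/
def IsKr (m : ℕ) (p q : Set (Set (Fin m))) : Prop :=
  NCPart q ∧ NCPart (interleave m p q) ∧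
  ∀ q', NCPart q' → NCPart (interleave m p q') → Refines q' q

/-- Two sets cross: there are `a < b < c < d` with `a, c ∈ B` and `b, d ∈ C`. -/
def Crossing {α : Type*} [LinearOrder α] (B C : Set α) : Prop :=
  ∃ a b c d : α, a < b ∧ b < c ∧ c < d ∧ a ∈ B ∧ c ∈ B ∧ b ∈ C ∧ d ∈ C

/-- Two members of a non-crossing family of pairwise disjoint sets: disjoint,
and neither crosses the other. -/
def PairNC {α : Type*} [LinearOrder α] (B C : Set α) : Prop :=
  Disjoint B C ∧ ¬ Crossing B C ∧ ¬ Crossing C B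

end NCPB
namespace NCPB

/-- The generating set `R_n` of the hyperoctahedral group: all transpositions `(i,-i)`
and all products `(i,j)(-i,-j)` with `|i| ≠ |j|`. -/
def Rn (n : ℕ) : Set (Equiv.Perm (Fin (2*n))) :=
  {ρ | (∃ i, ρ = Equiv.swap i (negMap n i)) ∨
       (∃ i j, absMap n i ≠ absMap n j ∧
          ρ = Equiv.swap i j * Equiv.swap (negMap n i) (negMap n j))}

/-- Membership in the hyperoctahedral group `W_n`: permutations of `[±n]` commuting
with the inversion map. -/
def InWn (n : ℕ) (τ : Equiv.Perm (Fin (2*n))) : Prop :=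
  ∀ k, τ (negMap n k) = negMap n (τ k)

/-- Word-length with respect to the generating set `R_n`. -/
noncomputable def lenB (n : ℕ) (τ : Equiv.Perm (Fin (2*n))) : ℕ :=
  sInf {k | ∃ l : List (Equiv.Perm (Fin (2*n))),
    (∀ ρ ∈ l, ρ ∈ Rn n) ∧ l.length = k ∧ l.prod = τ}

/-- The partial order on `W_n` coming from `(W_n, R_n)`: `a ≤ b` iff `|a| + |a⁻¹b| = |b|`. -/
def leB (n : ℕ) (a b : Equiv.Perm (Fin (2*n))) : Prop :=
  lenB n a + lenB n (a⁻¹ * b) = lenB n b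

/-- `b` covers `a` in the partial order coming from `(W_n, R_n)`. -/
def CoversB (n : ℕ) (a b : Equiv.Perm (Fin (2*n))) : Prop :=
  leB n a b ∧ lenB n b = lenB n a + 1

/-- The orbits of a permutation. -/
def orbitsOf (n : ℕ) (τ : Equiv.Perm (Fin (2*n))) : Set (Set (Fin (2*n))) :=
  {O | ∃ x, O = {y | τ.SameCycle x y}}

/-- Word-length with respect to the set of all transpositions of a symmetric group. -/
noncomputable def lenA (N : ℕ) (τ : Equiv.Perm (Fin N)) : ℕ :=
  sInf {k | ∃ l : List (Equiv.Perm (Fin N)),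
    (∀ ρ ∈ l, ρ.IsSwap) ∧ l.length = k ∧ l.prod = τ}

/-- The partial order on the symmetric group coming from all transpositions. -/
def leA (N : ℕ) (a b : Equiv.Perm (Fin N)) : Prop :=
  lenA N a + lenA N (a⁻¹ * b) = lenA N b

/-- `τ = ι(π)`: for each block `B` of `π` and `a ∈ B`, `τ a` is the cyclic successor of
`a` in `B` (the least element of `B` greater than `a`, or the least element of `B` if
`a` is the largest element of `B`). -/
def IsIota (N : ℕ) (π : Set (Set (Fin N))) (τ : Equiv.Perm (Fin N)) : Prop :=
  ∀ B ∈ π, ∀ a ∈ B,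
    ((∃ b ∈ B, a < b) → IsLeast {b | b ∈ B ∧ a < b} (τ a)) ∧
    ((∀ b ∈ B, ¬ a < b) → IsLeast B (τ a))

/-- The long inversion-invariant cycle `ω = (1, 2, ..., n, -1, -2, ..., -n)`. -/
def omegaW (n : ℕ) : Equiv.Perm (Fin (2*n)) := finRotate (2*n)

end NCPB
namespace NCPB

section Negation

variable {n : ℕ}

lemma negMap_val (k : Fin (2*n)) :
    (negMap n k).val = if k.val < n then k.val + n else k.val - n := by
  have hk := k.isLt
  simp only [negMap]
  split_ifs with h
  · exact Nat.mod_eq_of_lt (by omega)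
  · rw [show k.val + n = (k.val - n) + 2*n by omega, Nat.add_mod_right]
    exact Nat.mod_eq_of_lt (by omega)

lemma absMap_val (k : Fin (2*n)) :
    (absMap n k).val = if k.val < n then k.val else k.val - n := by
  have hk := k.isLt
  simp only [absMap]
  split_ifs with h
  · exact Nat.mod_eq_of_lt h
  · rw [show k.val = (k.val - n) + n by omega, Nat.add_mod_right]
    simpa using Nat.mod_eq_of_lt (by omega)

lemma negMap_negMap (k : Fin (2*n)) : negMap n (negMap n k) = k := by
  have hk := k.isLt
  apply Fin.ext
  rw [negMap_val, negMap_val]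
  split_ifs <;> omega

lemma negMap_injective : Function.Injective (negMap n) :=
  Function.LeftInverse.injective negMap_negMap

lemma negMap_ne (k : Fin (2*n)) : negMap n k ≠ k := by
  have hk := k.isLt
  intro h
  have := congrArg Fin.val h
  rw [negMap_val] at this
  split_ifs at this <;> omega

lemma absMap_eq_iff (x y : Fin (2*n)) :
    absMap n x = absMap n y ↔ x = y ∨ x = negMap n y := by
  have hx := x.isLt
  have hy := y.isLt
  rw [Fin.ext_iff, Fin.ext_iff, Fin.ext_iff, absMap_val, absMap_val, negMap_val]
  split_ifs <;> omega

lemma negMap_swap (i j k : Fin (2*n)) :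
    negMap n (Equiv.swap i j k) = Equiv.swap (negMap n i) (negMap n j) (negMap n k) :=
  (negMap_injective.swap_apply i j k).symm

lemma inWn_swap_negMap (i : Fin (2*n)) : InWn n (Equiv.swap i (negMap n i)) := by
  intro k
  rw [negMap_swap, negMap_negMap, Equiv.swap_comm]

lemma inWn_swap_mul_swap {i j : Fin (2*n)} (h : absMap n i ≠ absMap n j) :
    InWn n (Equiv.swap i j * Equiv.swap (negMap n i) (negMap n j)) := by
  intro k
  rw [Ne, absMap_eq_iff, not_or] at h
  have hi := negMap_ne i
  have hj := negMap_ne j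
  have hij : negMap n i ≠ j := fun h' => h.2 (by rw [← h', negMap_negMap])
  have hcomm : Commute (Equiv.swap i j) (Equiv.swap (negMap n i) (negMap n j)) := by
    apply Equiv.Perm.Disjoint.commute
    intro x
    by_cases h1 : x = i
    · right; subst h1; exact Equiv.swap_apply_of_ne_of_ne hi.symm h.2
    · by_cases h2 : x = j
      · right; subst h2; exact Equiv.swap_apply_of_ne_of_ne hij.symm hj.symm
      · left; exact Equiv.swap_apply_of_ne_of_ne h1 h2
  rw [hcomm.eq, Equiv.Perm.mul_apply, Equiv.Perm.mul_apply, negMap_swap, negMap_swap,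
    negMap_negMap, negMap_negMap, ← Equiv.Perm.mul_apply, ← Equiv.Perm.mul_apply, hcomm.eq]

lemma InWn.mul {σ τ : Equiv.Perm (Fin (2*n))} (hσ : InWn n σ) (hτ : InWn n τ) :
    InWn n (σ * τ) := fun k => by
  rw [Equiv.Perm.mul_apply, hτ, hσ, Equiv.Perm.mul_apply]

lemma InWn.inv {σ : Equiv.Perm (Fin (2*n))} (hσ : InWn n σ) : InWn n σ⁻¹ := fun k => by
  rw [Equiv.Perm.inv_eq_iff_eq, hσ, ← Equiv.Perm.mul_apply, mul_inv_cancel, Equiv.Perm.one_apply]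

lemma omegaW_val (k : Fin (2*n)) :
    (omegaW n k).val = if k.val + 1 < 2*n then k.val + 1 else 0 := by
  obtain ⟨m, hm⟩ : ∃ m, 2*n = m + 1 := ⟨2*n - 1, by have := k.isLt; omega⟩
  unfold omegaW
  revert k
  rw [hm]
  intro k
  rw [coe_finRotate]
  have := k.isLt
  simp only [Fin.ext_iff, Fin.val_last]
  split_ifs <;> omega

lemma inWn_omegaW : InWn n (omegaW n) := by
  intro k
  have := k.isLt
  apply Fin.ext
  rw [omegaW_val, negMap_val, negMap_val, omegaW_val]
  split_ifs <;> omega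

end Negation

section Length

variable {n : ℕ}

lemma rel_of_sameCycle {α : Type*} [Finite α] {σ : Equiv.Perm α} {R : α → α → Prop}
    (hR : Equivalence R) (hσ : ∀ a, R a (σ a)) {a b : α} (h : σ.SameCycle a b) : R a b := by
  obtain ⟨i, -, rfl⟩ := h.exists_pow_eq'
  induction i with
  | zero => exact hR.refl a
  | succ i ih =>
    rw [pow_succ', Equiv.Perm.mul_apply]
    refine hR.trans (ih ?_) (hσ _)
    exact ⟨i, by simp⟩

/-- A product decomposition of `τ` whose first factor separates both `x` and `-x` from their
cycles. -/
lemma exists_reflection_mul {τ : Equiv.Perm (Fin (2*n))} (hτ : InWn n τ) {x : Fin (2*n)}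
    (hx : τ x ≠ x) :
    ∃ r ∈ Rn n, InWn n (r * τ) ∧ r * r = 1 ∧ (r * τ) x = x ∧
      ∀ a, τ.SameCycle a ((r * τ) a) := by
  have hxy : τ.SameCycle x (τ x) := ⟨1, by simp⟩
  have hself : ∀ a, τ.SameCycle a (τ a) := fun a => ⟨1, by simp⟩
  by_cases h : τ x = negMap n x
  · refine ⟨Equiv.swap x (negMap n x), Or.inl ⟨x, rfl⟩, (inWn_swap_negMap x).mul hτ,
      Equiv.swap_mul_self _ _, by simp [h], fun a => (hself a).trans ?_⟩
    rw [h] at hxy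
    rw [Equiv.Perm.mul_apply, Equiv.swap_apply_def]
    split_ifs with h1 h2
    · rw [h1]; exact hxy
    · rw [h2]; exact hxy.symm
    · exact Equiv.Perm.SameCycle.refl _ _
  · set y := τ x with hy
    have habs : absMap n x ≠ absMap n y := by
      rw [Ne, absMap_eq_iff, not_or]
      exact ⟨fun h' => hx h'.symm, fun h' => h (by rw [h', negMap_negMap])⟩
    have hneg : τ.SameCycle (negMap n x) (negMap n y) := ⟨1, by rw [zpow_one, hτ]⟩
    have hyx : y ≠ negMap n x := h
    have hyy := negMap_ne y
    have hxx := negMap_ne x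
    have hxny : x ≠ negMap n y := fun h' => h (by rw [h', negMap_negMap])
    refine ⟨_, Or.inr ⟨x, y, habs, rfl⟩, (inWn_swap_mul_swap habs).mul hτ, ?_, ?_,
      fun a => (hself a).trans ?_⟩
    · ext1 k
      simp only [Equiv.Perm.mul_apply, Equiv.Perm.one_apply]
      simp only [Equiv.swap_apply_def]
      grind
    · rw [Equiv.Perm.mul_apply, ← hy, Equiv.Perm.mul_apply,
        Equiv.swap_apply_of_ne_of_ne hyx hyy.symm, Equiv.swap_apply_right]
    · rw [Equiv.Perm.mul_apply]
      generalize τ a = b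
      have hrel : ∀ {u v : Fin (2*n)}, τ.SameCycle u v → ∀ b, τ.SameCycle b (Equiv.swap u v b) := by
        intro u v huv b
        rw [Equiv.swap_apply_def]
        split_ifs with h1 h2
        · rw [h1]; exact huv
        · rw [h2]; exact huv.symm
        · exact Equiv.Perm.SameCycle.refl _ _
      exact (hrel hneg b).trans (hrel hxy _)

lemma card_le_of_separated {τ : Equiv.Perm (Fin (2*n))} {T : Finset (Fin (2*n))}
    (h : ∀ s ∈ T, ∀ t ∈ T, ¬ τ.SameCycle s (negMap n t)) : T.card ≤ n := by
  have := Finset.card_le_card_of_injOn (t := (Finset.univ : Finset (Fin n))) (absMap n)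
    (s := T) (fun _ _ => Finset.mem_coe.2 (Finset.mem_univ _)) (fun s hs t ht hst => by
      rcases (absMap_eq_iff s t).1 hst with h' | h'
      · exact h'
      · exact absurd (h' ▸ Equiv.Perm.SameCycle.refl τ s) (h s hs t ht))
  simpa using this

/-- If the elements of `T ∪ -T` lie in pairwise distinct cycles of `τ`, then `τ` is a product of
at most `n - |T|` reflections. -/
lemma exists_reflections_of_separated (k : ℕ) : ∀ (τ : Equiv.Perm (Fin (2*n)))
    (T : Finset (Fin (2*n))), InWn n τ →
    (∀ s ∈ T, ∀ t ∈ T, τ.SameCycle s t → s = t) →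
    (∀ s ∈ T, ∀ t ∈ T, ¬ τ.SameCycle s (negMap n t)) → n < T.card + k →
    ∃ l : List (Equiv.Perm (Fin (2*n))), (∀ ρ ∈ l, ρ ∈ Rn n) ∧ l.prod = τ ∧
      l.length + T.card ≤ n := by
  induction k with
  | zero =>
    intro τ T _ _ h2 hk
    have := card_le_of_separated h2
    omega
  | succ k ih =>
    intro τ T hτ h1 h2 hk
    by_cases hone : τ = 1
    · exact ⟨[], by simp, by simp [hone], by simpa using card_le_of_separated h2⟩
    obtain ⟨x, hx, hxT, hxT'⟩ : ∃ x, τ x ≠ x ∧ x ∉ T ∧ negMap n x ∉ T := by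
      have key : ∀ x ∈ T, τ x ≠ x → ∃ x, τ x ≠ x ∧ x ∉ T ∧ negMap n x ∉ T := by
        intro x hxT hx
        refine ⟨τ x, fun h => hx (τ.injective h), fun h => hx ?_, fun h => ?_⟩
        · exact (h1 x hxT _ h ⟨1, by simp⟩).symm
        · exact h2 x hxT _ h (by rw [negMap_negMap]; exact ⟨1, by simp⟩)
      obtain ⟨x, hx⟩ : ∃ x, τ x ≠ x := by
        by_contra! h
        exact hone (Equiv.ext h)
      by_cases hxT : x ∈ T
      · exact key x hxT hx
      by_cases hxT' : negMap n x ∈ T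
      · exact key _ hxT' (fun h => hx (negMap_injective (by rw [← hτ, h])))
      · exact ⟨x, hx, hxT, hxT'⟩
    obtain ⟨r, hr, hrW, hrr, hrx, hsub⟩ := exists_reflection_mul hτ hx
    have hsame : ∀ {a b}, (r * τ).SameCycle a b → τ.SameCycle a b := fun h =>
      rel_of_sameCycle ⟨Equiv.Perm.SameCycle.refl _, fun h => h.symm, fun h h' => h.trans h'⟩
        hsub h
    have hrnx : (r * τ) (negMap n x) = negMap n x := by rw [hrW, hrx]
    have hfix : ∀ {a b}, (r * τ) a = a → (r * τ).SameCycle a b → a = b := fun ha h =>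
      (h.eq_of_left ha)
    obtain ⟨l, hl, hprod, hlen⟩ := ih (r * τ) (insert x T) hrW
      (by
        intro s hs t ht hst
        rcases Finset.mem_insert.1 hs with rfl | hs
        · exact hfix hrx hst
        rcases Finset.mem_insert.1 ht with rfl | ht
        · exact (hfix hrx hst.symm).symm
        exact h1 s hs t ht (hsame hst))
      (by
        intro s hs t ht hst
        rcases Finset.mem_insert.1 hs with rfl | hsT
        · have h := hfix hrx hst
          rcases Finset.mem_insert.1 ht with rfl | ht
          · exact negMap_ne _ h.symm
          · exact hxT' (by rw [h, negMap_negMap]; exact ht)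
        rcases Finset.mem_insert.1 ht with rfl | ht
        · rw [← hfix hrnx hst.symm] at hsT
          exact hxT' hsT
        exact h2 s hsT t ht (hsame hst))
      (by rw [Finset.card_insert_of_notMem hxT]; omega)
    rw [Finset.card_insert_of_notMem hxT] at hlen
    refine ⟨r :: l, ?_, ?_, by rw [List.length_cons]; omega⟩
    · intro ρ hρ
      rcases List.mem_cons.1 hρ with rfl | hρ
      · exact hr
      · exact hl ρ hρ
    · rw [List.prod_cons, hprod, ← mul_assoc, hrr, one_mul]

/-- A permutation in `W_n` preserving the classes of a `-`-invariant equivalence relation (given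
by a choice `f` of representatives) with at most one class `X = -X` has small length. -/
lemma exists_reflections_of_representative {τ : Equiv.Perm (Fin (2*n))} (hτ : InWn n τ)
    {f : Fin (2*n) → Fin (2*n)} (hidem : ∀ x, f (f x) = f x)
    (hneg : ∀ x y, f x = f y → f (negMap n x) = f (negMap n y))
    (hzero : ∀ x y, f x = f (negMap n x) → f y = f (negMap n y) → f x = f y)
    (hf : ∀ x, f (τ x) = f x) :
    ∃ l : List (Equiv.Perm (Fin (2*n))), (∀ ρ ∈ l, ρ ∈ Rn n) ∧ l.prod = τ ∧
      2 * l.length + (Finset.univ.filter fun x => f x = x).card ≤ 2 * n + 1 := by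
  have hsame : ∀ {a b}, τ.SameCycle a b → f a = f b := fun h =>
    rel_of_sameCycle (R := fun a b => f a = f b) ⟨fun _ => rfl, fun h => h.symm,
      fun h h' => h.trans h'⟩ (fun a => (hf a).symm) h
  set Z := Finset.univ.filter fun x => f x = x ∧ f (negMap n x) = x with hZ
  set T := Finset.univ.filter fun x => f x = x ∧ x < f (negMap n x) with hT
  set U := Finset.univ.filter fun x => f x = x ∧ f (negMap n x) < x with hU
  have hpart : ∀ x, f x = x → f (negMap n (f (negMap n x))) = x := fun x hx => by
    rw [hneg _ (negMap n x) (hidem _), negMap_negMap, hx]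
  have hcover : (Finset.univ.filter fun x => f x = x) ⊆ Z ∪ (T ∪ U) := by
    intro x hx
    simp only [hZ, hT, hU, Finset.mem_union, Finset.mem_filter, Finset.mem_univ, true_and]
      at hx ⊢
    rcases lt_trichotomy x (f (negMap n x)) with h | h | h
    · exact Or.inr (Or.inl ⟨hx, h⟩)
    · exact Or.inl ⟨hx, h.symm⟩
    · exact Or.inr (Or.inr ⟨hx, h⟩)
  have hZcard : Z.card ≤ 1 := by
    rw [Finset.card_le_one]
    intro a ha b hb
    simp only [hZ, Finset.mem_filter, Finset.mem_univ, true_and] at ha hb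
    rw [← ha.1, ← hb.1]
    exact hzero a b (ha.1.trans ha.2.symm) (hb.1.trans hb.2.symm)
  have hUT : U.card ≤ T.card := by
    apply Finset.card_le_card_of_injOn (fun x => f (negMap n x))
    · intro x hx
      simp only [hT, hU, Finset.coe_filter, Finset.mem_univ, true_and, Set.mem_ofPred_eq] at hx ⊢
      refine ⟨hidem _, ?_⟩
      rw [hpart x hx.1]
      exact hx.2
    · intro x hx y hy hxy
      simp only [hU, Finset.coe_filter, Finset.mem_univ, true_and, Set.mem_ofPred_eq] at hx hy hxy
      rw [← hpart x hx.1, ← hpart y hy.1, hxy]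
  obtain ⟨l, hl, hprod, hlen⟩ := exists_reflections_of_separated (n + 1) τ T hτ
    (by
      intro s hs t ht hst
      simp only [hT, Finset.mem_filter, Finset.mem_univ, true_and] at hs ht
      rw [← hs.1, ← ht.1]
      exact hsame hst)
    (by
      intro s hs t ht hst
      simp only [hT, Finset.mem_filter, Finset.mem_univ, true_and] at hs ht
      have h1 : s = f (negMap n t) := hs.1.symm.trans (hsame hst)
      have h2 : f (negMap n s) = t := by rw [h1, hpart t ht.1]
      have h3 := hs.2
      have h4 := ht.2
      rw [h2] at h3
      rw [← h1] at h4
      exact lt_asymm h3 h4)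
    (by omega)
  refine ⟨l, hl, hprod, ?_⟩
  have c1 := Finset.card_le_card hcover
  have c2 := Finset.card_union_le Z (T ∪ U)
  have c3 := Finset.card_union_le T U
  omega

/-- The antisymmetric function on `[±n]` extending `v`. -/
def antisymm (v : Fin n → ℚ) (x : Fin (2*n)) : ℚ :=
  if x.val < n then v (absMap n x) else - v (absMap n x)

lemma antisymm_negMap (v : Fin n → ℚ) (x : Fin (2*n)) :
    antisymm v (negMap n x) = - antisymm v x := by
  have hx := x.isLt
  have h : absMap n (negMap n x) = absMap n x := (absMap_eq_iff _ _).2 (Or.inr rfl)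
  unfold antisymm
  rw [h, negMap_val]
  split_ifs <;> first | omega | simp

/-- Evaluation of antisymmetric functions at a point. -/
def antisymmEval (x : Fin (2*n)) : (Fin n → ℚ) →ₗ[ℚ] ℚ where
  toFun v := antisymm v x
  map_add' v w := by unfold antisymm; split_ifs <;> simp [add_comm]
  map_smul' c v := by unfold antisymm; split_ifs <;> simp

lemma antisymmEval_apply (x : Fin (2*n)) (v : Fin n → ℚ) : antisymmEval x v = antisymm v x := rfl

lemma exists_functional_of_mem_Rn {r : Equiv.Perm (Fin (2*n))} (hr : r ∈ Rn n) :
    ∃ φ : (Fin n → ℚ) →ₗ[ℚ] ℚ, ∀ v, φ v = 0 → ∀ x, antisymm v (r x) = antisymm v x := by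
  rcases hr with ⟨i, rfl⟩ | ⟨i, j, -, rfl⟩
  · refine ⟨antisymmEval i, fun v hv x => ?_⟩
    rw [antisymmEval_apply] at hv
    rw [Equiv.swap_apply_def]
    split_ifs with h1 h2
    · rw [h1, antisymm_negMap, hv, neg_zero]
    · rw [h2, antisymm_negMap, hv, neg_zero]
    · rfl
  · refine ⟨antisymmEval i - antisymmEval j, fun v hv x => ?_⟩
    rw [LinearMap.sub_apply, antisymmEval_apply, antisymmEval_apply, sub_eq_zero] at hv
    have hswap : ∀ a b : Fin (2*n), antisymm v a = antisymm v b → ∀ x,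
        antisymm v (Equiv.swap a b x) = antisymm v x := by
      intro a b hab x
      rw [Equiv.swap_apply_def]
      split_ifs with h1 h2
      · rw [h1, hab]
      · rw [h2, hab]
      · rfl
    rw [Equiv.Perm.mul_apply, hswap i j hv, hswap]
    rw [antisymm_negMap, antisymm_negMap, hv]

lemma antisymm_eq_zero_of_omegaW {v : Fin n → ℚ}
    (h : ∀ x, antisymm v (omegaW n x) = antisymm v x) : v = 0 := by
  funext i
  have hi := i.isLt
  have key : ∀ k (hk : k < 2*n), antisymm v ⟨k, hk⟩ = antisymm v ⟨0, by omega⟩ := by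
    intro k
    induction k with
    | zero => intro _; rfl
    | succ k ih =>
      intro hk
      rw [← ih (by omega), ← h ⟨k, by omega⟩]
      congr 1
      apply Fin.ext
      rw [omegaW_val]
      simp [hk]
  have hneg := antisymm_negMap v ⟨i, by omega⟩
  have h1 := key _ (negMap n ⟨i, by omega⟩).isLt
  have h2 := key i (by omega)
  have h3 : antisymm v ⟨i, by omega⟩ = v i := by
    unfold antisymm
    rw [if_pos hi]
    congr 1
    apply Fin.ext
    rw [absMap_val]
    simp
  rw [Fin.eta] at h1
  rw [Pi.zero_apply]
  linarith

/-- The long cycle is not a product of fewer than `n` reflections. -/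
lemma le_length_of_prod_eq_omegaW {l : List (Equiv.Perm (Fin (2*n)))}
    (hl : ∀ ρ ∈ l, ρ ∈ Rn n) (hprod : l.prod = omegaW n) : n ≤ l.length := by
  by_contra! hlt
  choose φ hφ using fun i : Fin l.length => exists_functional_of_mem_Rn (hl _ (l.get_mem i))
  have hker := LinearMap.ker_ne_bot_of_finrank_lt (f := LinearMap.pi φ) (by simpa using hlt)
  obtain ⟨v, hv, hv0⟩ := (Submodule.ne_bot_iff _).1 hker
  refine hv0 (antisymm_eq_zero_of_omegaW ?_)
  have hfix : ∀ r ∈ l, ∀ x, antisymm v (r x) = antisymm v x := by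
    intro r hr
    obtain ⟨i, rfl⟩ := List.get_of_mem hr
    exact hφ i v (by simpa using congrFun (LinearMap.mem_ker.1 hv) i)
  rw [← hprod]
  clear hprod hφ hker hv hlt hl φ
  induction l with
  | nil => intro x; rfl
  | cons r l ih =>
    intro x
    rw [List.prod_cons, Equiv.Perm.mul_apply, hfix r (by simp),
      ih (fun r hr => hfix r (by simp [hr]))]

lemma lenB_le {l : List (Equiv.Perm (Fin (2*n)))} (hl : ∀ ρ ∈ l, ρ ∈ Rn n) :
    lenB n l.prod ≤ l.length := Nat.sInf_le ⟨l, hl, rfl, rfl⟩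

lemma exists_length_eq_lenB {l : List (Equiv.Perm (Fin (2*n)))} (hl : ∀ ρ ∈ l, ρ ∈ Rn n) :
    ∃ l' : List (Equiv.Perm (Fin (2*n))), (∀ ρ ∈ l', ρ ∈ Rn n) ∧
      l'.length = lenB n l.prod ∧ l'.prod = l.prod :=
  Nat.sInf_mem (s := {k | ∃ l' : List (Equiv.Perm (Fin (2*n))), (∀ ρ ∈ l', ρ ∈ Rn n) ∧
    l'.length = k ∧ l'.prod = l.prod}) ⟨_, l, hl, rfl, rfl⟩

end Length

section Partition

variable {N : ℕ}

/-- The equivalence relation `being in the same block`. -/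
def SameBlock {α : Type*} (P : Set (Set α)) (x y : α) : Prop := ∃ B ∈ P, x ∈ B ∧ y ∈ B

lemma IsPartition.eq_of_mem {α : Type*} {P : Set (Set α)} (h : IsPartition P) {B C : Set α}
    (hB : B ∈ P) (hC : C ∈ P) {x : α} (hxB : x ∈ B) (hxC : x ∈ C) : B = C :=
  (h.2 x).unique ⟨hB, hxB⟩ ⟨hC, hxC⟩

lemma IsPartition.sameBlock_iff {α : Type*} {P : Set (Set α)} (h : IsPartition P) {B : Set α}
    (hB : B ∈ P) {x y : α} (hx : x ∈ B) : SameBlock P x y ↔ y ∈ B := by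
  constructor
  · rintro ⟨C, hC, hxC, hyC⟩
    rwa [h.eq_of_mem hB hC hx hxC]
  · exact fun hy => ⟨B, hB, hx, hy⟩

lemma IsPartition.equivalence {α : Type*} {P : Set (Set α)} (h : IsPartition P) :
    Equivalence (SameBlock P) where
  refl x := by
    obtain ⟨B, ⟨hB, hx⟩, -⟩ := h.2 x
    exact ⟨B, hB, hx, hx⟩
  symm := fun ⟨B, hB, hx, hy⟩ => ⟨B, hB, hy, hx⟩
  trans := fun ⟨B, hB, hx, hy⟩ hyz => ⟨B, hB, hx, (h.sameBlock_iff hB hy).1 hyz⟩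

lemma NCPart.sameBlock_of_lt {α : Type*} [LinearOrder α] {P : Set (Set α)} (h : NCPart P)
    {a b c d : α} (hab : a < b) (hbc : b < c) (hcd : c < d) (hac : SameBlock P a c)
    (hbd : SameBlock P b d) : SameBlock P a b := by
  obtain ⟨B, hB, haB, hcB⟩ := hac
  obtain ⟨C, hC, hbC, hdC⟩ := hbd
  exact ⟨B, hB, haB, h.2 B hB C hC a b c d hab hbc hcd haB hcB hbC hdC⟩

lemma IsPartition.interleave {p q : Set (Set (Fin N))} (hp : IsPartition p) (hq : IsPartition q) :
    IsPartition (interleave N p q) := by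
  have hne : ∀ a b : Fin N, evens N a ≠ odds N b := by
    intro a b h
    have := congrArg Fin.val h
    simp only [evens, odds] at this
    omega
  have he : Function.Injective (evens N) := by
    intro a b h
    have := congrArg Fin.val h
    simp only [evens] at this
    exact Fin.ext (by omega)
  have ho : Function.Injective (odds N) := by
    intro a b h
    have := congrArg Fin.val h
    simp only [odds] at this
    exact Fin.ext (by omega)
  refine ⟨?_, fun a => ?_⟩
  · rintro _ (⟨B, hB, rfl⟩ | ⟨B, hB, rfl⟩)
    · exact (hp.1 B hB).image _
    · exact (hq.1 B hB).image _
  · have ha := a.isLt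
    rcases Nat.even_or_odd' a.val with ⟨k, hk | hk⟩
    · rw [show a = evens N ⟨k, by omega⟩ from Fin.ext hk]
      obtain ⟨B, ⟨hB, hkB⟩, -⟩ := hp.2 ⟨k, by omega⟩
      refine ⟨_, ⟨Or.inl ⟨B, hB, rfl⟩, Set.mem_image_of_mem _ hkB⟩, ?_⟩
      rintro _ ⟨⟨C, hC, rfl⟩ | ⟨C, hC, rfl⟩, b, hb, hab⟩
      · rw [he hab] at hb
        change evens N '' C = evens N '' B
        rw [hp.eq_of_mem hC hB hb hkB]
      · exact absurd hab.symm (hne _ _)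
    · rw [show a = odds N ⟨k, by omega⟩ from Fin.ext hk]
      obtain ⟨B, ⟨hB, hkB⟩, -⟩ := hq.2 ⟨k, by omega⟩
      refine ⟨_, ⟨Or.inr ⟨B, hB, rfl⟩, Set.mem_image_of_mem _ hkB⟩, ?_⟩
      rintro _ ⟨⟨C, hC, rfl⟩ | ⟨C, hC, rfl⟩, b, hb, hab⟩
      · exact absurd hab (hne _ _)
      · rw [ho hab] at hb
        change odds N '' C = odds N '' B
        rw [hq.eq_of_mem hC hB hb hkB]

/-- The partition whose only block with more than one element is `{i, j}`. -/
def pairPart {α : Type*} (i j : α) : Set (Set α) :=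
  {S | S = {i, j} ∨ ∃ k, k ≠ i ∧ k ≠ j ∧ S = {k}}

lemma isPartition_pairPart {α : Type*} (i j : α) : IsPartition (pairPart i j) := by
  refine ⟨?_, fun a => ?_⟩
  · rintro _ (rfl | ⟨k, -, -, rfl⟩)
    · exact ⟨i, by simp⟩
    · exact ⟨k, rfl⟩
  · by_cases h : a = i ∨ a = j
    · refine ⟨{i, j}, ⟨Or.inl rfl, h⟩, ?_⟩
      rintro _ ⟨rfl | ⟨k, hi, hj, rfl⟩, ha⟩
      · rfl
      · rw [Set.mem_singleton_iff] at ha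
        subst ha
        rcases h with h | h
        · exact absurd h hi
        · exact absurd h hj
    · push Not at h
      refine ⟨{a}, ⟨Or.inr ⟨a, h.1, h.2, rfl⟩, rfl⟩, ?_⟩
      rintro _ ⟨rfl | ⟨k, hi, hj, rfl⟩, ha⟩
      · rcases ha with ha | ha
        · exact absurd ha h.1
        · exact absurd ha h.2
      · rw [Set.mem_singleton_iff.1 ha]

lemma eq_of_mem_pairPart {α : Type*} [LinearOrder α] {i j : α} (hij : i < j) {B : Set α}
    (hB : B ∈ pairPart i j) {a b : α} (ha : a ∈ B) (hb : b ∈ B) (hab : a < b) :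
    a = i ∧ b = j := by
  rcases hB with rfl | ⟨k, -, -, rfl⟩
  · rcases ha with rfl | rfl <;> rcases hb with rfl | rfl
    · exact absurd hab (lt_irrefl _)
    · exact ⟨rfl, rfl⟩
    · exact absurd hab (lt_asymm hij)
    · exact absurd hab (lt_irrefl _)
  · rw [Set.mem_singleton_iff.1 ha, Set.mem_singleton_iff.1 hb] at hab
    exact absurd hab (lt_irrefl _)

lemma ncPart_pairPart {α : Type*} [LinearOrder α] {i j : α} (hij : i < j) :
    NCPart (pairPart i j) := by
  refine ⟨isPartition_pairPart i j, ?_⟩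
  intro B hB C hC a b c d hab hbc hcd ha hc hb hd
  have h1 := eq_of_mem_pairPart hij hB ha hc (hab.trans hbc)
  have h2 := eq_of_mem_pairPart hij hC hb hd (hbc.trans hcd)
  rw [h1.1, h2.1] at hab
  exact absurd hab (lt_irrefl _)

lemma ncPart_interleave_pairPart {p : Set (Set (Fin N))} (hp : NCPart p) {i j : Fin N}
    (hij : i < j)
    (h : ∀ a b, SameBlock p a b → i < a → a ≤ j → i < b ∧ b ≤ j) :
    NCPart (interleave N p (pairPart i j)) := by
  refine ⟨hp.1.interleave (isPartition_pairPart i j), ?_⟩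
  rintro _ (⟨B, hB, rfl⟩ | ⟨B, hB, rfl⟩) _ (⟨C, hC, rfl⟩ | ⟨C, hC, rfl⟩) _ _ _ _ hab hbc hcd
    ⟨a, ha, rfl⟩ ⟨c, hc, rfl⟩ ⟨b, hb, rfl⟩ ⟨d, hd, rfl⟩ <;>
  simp only [evens, odds, Fin.mk_lt_mk] at hab hbc hcd
  · exact Set.mem_image_of_mem _ (hp.2 B hB C hC a b c d (by omega) (by omega) (by omega)
      ha hc hb hd)
  · obtain ⟨rfl, rfl⟩ := eq_of_mem_pairPart hij hC hb hd (by omega)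
    have := h c a ⟨B, hB, hc, ha⟩ (by omega) (by omega)
    omega
  · obtain ⟨rfl, rfl⟩ := eq_of_mem_pairPart hij hB ha hc (by omega)
    have := h b d ⟨C, hC, hb, hd⟩ (by omega) (by omega)
    omega
  · obtain ⟨rfl, rfl⟩ := eq_of_mem_pairPart hij hB ha hc (by omega)
    obtain ⟨rfl, rfl⟩ := eq_of_mem_pairPart hij hC hb hd (by omega)
    omega

/-- Two elements `i < j` are in the same block of the Kreweras complement iff `(i, j]` is a union
of blocks. -/
lemma IsKr.sameBlock_iff {p q : Set (Set (Fin N))} (hp : NCPart p) (h : IsKr N p q) {i j : Fin N}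
    (hij : i < j) :
    SameBlock q i j ↔ ∀ a b, SameBlock p a b → i < a → a ≤ j → i < b ∧ b ≤ j := by
  constructor
  · rintro ⟨C, hC, hi, hj⟩ a b ⟨B, hB, ha, hb⟩ hia haj
    have hC' : odds N '' C ∈ interleave N p q := Or.inr ⟨C, hC, rfl⟩
    have hB' : evens N '' B ∈ interleave N p q := Or.inl ⟨B, hB, rfl⟩
    have hdisj : ∀ x y, x ∈ odds N '' C → x = evens N y → False := by
      rintro _ y ⟨z, -, rfl⟩ hx
      have := congrArg Fin.val hx
      simp only [evens, odds] at this
      omega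
    by_contra hcon
    rcases le_or_gt b i with hbi | hib
    · have hmem := h.2.1.2 _ hB' _ hC' (evens N b) (odds N i) (evens N a) (odds N j)
        (by simp only [evens, odds, Fin.mk_lt_mk]; omega)
        (by simp only [evens, odds, Fin.mk_lt_mk]; omega)
        (by simp only [evens, odds, Fin.mk_lt_mk]; omega)
        ⟨b, hb, rfl⟩ ⟨a, ha, rfl⟩ ⟨i, hi, rfl⟩ ⟨j, hj, rfl⟩
      obtain ⟨y, -, hy⟩ := hmem
      exact hdisj _ y ⟨i, hi, rfl⟩ hy.symm
    · have hmem := h.2.1.2 _ hC' _ hB' (odds N i) (evens N a) (odds N j) (evens N b)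
        (by simp only [evens, odds, Fin.mk_lt_mk]; omega)
        (by simp only [evens, odds, Fin.mk_lt_mk]; omega)
        (by simp only [evens, odds, Fin.mk_lt_mk]; omega)
        ⟨i, hi, rfl⟩ ⟨j, hj, rfl⟩ ⟨a, ha, rfl⟩ ⟨b, hb, rfl⟩
      exact hdisj _ a hmem rfl
  · intro hS
    obtain ⟨C, hC, hsub⟩ := h.2.2 _ (ncPart_pairPart hij) (ncPart_interleave_pairPart hp hij hS)
      {i, j} (Or.inl rfl)
    exact ⟨C, hC, hsub (by simp), hsub (by simp)⟩

lemma exists_min_representative {P : Set (Set (Fin N))} (h : IsPartition P) :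
    ∃ f : Fin N → Fin N, (∀ x, SameBlock P x (f x)) ∧ ∀ x y, SameBlock P x y → f x ≤ y := by
  have key : ∀ x, ∃ m, SameBlock P x m ∧ ∀ y, SameBlock P x y → m ≤ y := fun x =>
    Set.exists_min_image {y | SameBlock P x y} id (Set.toFinite _) ⟨x, h.equivalence.refl x⟩
  choose f hf using key
  exact ⟨f, fun x => (hf x).1, fun x => (hf x).2⟩

lemma exists_max_representative {P : Set (Set (Fin N))} (h : IsPartition P) :
    ∃ f : Fin N → Fin N, (∀ x, SameBlock P x (f x)) ∧ ∀ x y, SameBlock P x y → y ≤ f x := by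
  have key : ∀ x, ∃ m, SameBlock P x m ∧ ∀ y, SameBlock P x y → y ≤ m := fun x =>
    Set.exists_max_image {y | SameBlock P x y} id (Set.toFinite _) ⟨x, h.equivalence.refl x⟩
  choose f hf using key
  exact ⟨f, fun x => (hf x).1, fun x => (hf x).2⟩

lemma IsIota.mem {P : Set (Set (Fin N))} {τ : Equiv.Perm (Fin N)} (hτ : IsIota N P τ)
    {B : Set (Fin N)} (hB : B ∈ P) {a : Fin N} (ha : a ∈ B) : τ a ∈ B := by
  by_cases h : ∃ b ∈ B, a < b
  · exact (((hτ B hB a ha).1 h).1).1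
  · push Not at h
    exact ((hτ B hB a ha).2 fun b hb => not_lt.2 (h b hb)).1

lemma IsIota.sameBlock {P : Set (Set (Fin N))} {τ : Equiv.Perm (Fin N)} (h : IsPartition P)
    (hτ : IsIota N P τ) (a : Fin N) : SameBlock P a (τ a) := by
  obtain ⟨B, ⟨hB, ha⟩, -⟩ := h.2 a
  exact ⟨B, hB, ha, hτ.mem hB ha⟩

/-- The positive cyclic distance from `a` to `c`. -/
def cyclicGap (a c : Fin N) : ℕ := if a < c then c.val - a.val else c.val + N - a.val

lemma IsIota.cyclicGap_le {P : Set (Set (Fin N))} {τ : Equiv.Perm (Fin N)} (hτ : IsIota N P τ)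
    {B : Set (Fin N)} (hB : B ∈ P) {a c : Fin N} (ha : a ∈ B) (hc : c ∈ B) :
    cyclicGap a (τ a) ≤ cyclicGap a c := by
  have h1 := (τ a).isLt
  have h2 := c.isLt
  have h3 := a.isLt
  by_cases h : ∃ b ∈ B, a < b
  · obtain ⟨⟨-, h4⟩, h5⟩ := (hτ B hB a ha).1 h
    unfold cyclicGap
    rw [if_pos h4]
    split_ifs with h6
    · have h7 : τ a ≤ c := h5 ⟨hc, h6⟩
      omega
    · omega
  · push Not at h
    obtain ⟨h4, h5⟩ := (hτ B hB a ha).2 fun b hb => not_lt.2 (h b hb)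
    have h6 := h5 hc
    have h7 := h _ h4
    have h8 := h c hc
    unfold cyclicGap
    rw [if_neg (not_lt.2 h7), if_neg (not_lt.2 h8)]
    omega

/-- `τ' i` is the `τ`-preimage of the cyclic successor `k` of `i`; moreover `k` is the minimum of
its block or `i` is the maximum of its block in the Kreweras complement. -/
lemma IsKr.iota_apply {p q : Set (Set (Fin N))} (hp : NCPart p) (h : IsKr N p q)
    {τ τ' : Equiv.Perm (Fin N)} (hτ : IsIota N p τ) (hτ' : IsIota N q τ') {i j k : Fin N}
    (hk : k.val = if i.val + 1 < N then i.val + 1 else 0) (hjk : τ j = k) :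
    τ' i = j ∧ ((∀ b, SameBlock p k b → k ≤ b) ∨ (∀ c, SameBlock q i c → c ≤ i)) := by
  obtain ⟨B, ⟨hB, hjB⟩, -⟩ := hp.1.2 j
  obtain ⟨C, ⟨hC, hiC⟩, -⟩ := h.1.1.2 i
  have hkB : k ∈ B := hjk ▸ hτ.mem hB hjB
  have hkj : SameBlock p k j := ⟨B, hB, hkB, hjB⟩
  have hjk' : SameBlock p j k := ⟨B, hB, hjB, hkB⟩
  have hmemB : ∀ {a b}, SameBlock p a b → (a ∈ B ↔ b ∈ B) := fun {a b} hab =>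
    ⟨fun ha => (hp.1.sameBlock_iff hB ha).1 hab,
      fun hb => (hp.1.sameBlock_iff hB hb).1 (hp.1.equivalence.symm hab)⟩
  have hi := i.isLt
  have hkN := k.isLt
  by_cases hmax : ∃ b ∈ B, j < b
  · obtain ⟨⟨-, hjk_lt⟩, hleast⟩ := (hτ B hB j hjB).1 hmax
    rw [hjk] at hjk_lt hleast
    have hgap : ∀ b ∈ B, j < b → k ≤ b := fun b hb hjb => hleast ⟨hb, hjb⟩
    have hki : k.val = i.val + 1 := by split_ifs at hk <;> omega
    have hjC : j ∈ C := by
      rcases eq_or_lt_of_le (show j ≤ i by omega) with rfl | hji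
      · exact hiC
      refine (h.1.1.sameBlock_iff hC hiC).1 (h.1.1.equivalence.symm
        ((h.sameBlock_iff hp hji).2 fun a b hab hja hai => ?_))
      by_cases haB : a ∈ B
      · have := hgap a haB hja
        omega
      have hbB : b ∉ B := fun hb => haB ((hmemB hab).2 hb)
      have hbj : b ≠ j := fun hb => hbB (hb ▸ hjB)
      have hbk : b ≠ k := fun hb => hbB (hb ▸ hkB)
      by_contra hcon
      rcases lt_or_gt_of_ne hbj with hlt | hgt
      · have := hp.sameBlock_of_lt hlt hja (show a < k by omega)
          (hp.1.equivalence.symm hab) hjk'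
        exact hbB ((hmemB this).2 hjB)
      · have := hp.sameBlock_of_lt hja (show a < k by omega) (show k < b by omega) hjk' hab
        exact haB ((hmemB this).1 hjB)
    have hCi : ∀ c ∈ C, c ≤ i := by
      intro c hc
      by_contra! hlt
      have := (h.sameBlock_iff hp hlt).1 ⟨C, hC, hiC, hc⟩ k j hkj (by omega) (by omega)
      omega
    have hCj : ∀ c ∈ C, j ≤ c := by
      intro c hc
      by_contra! hlt
      have := (h.sameBlock_iff hp (show c < i by omega)).1 ⟨C, hC, hc, hiC⟩ j k hjk' hlt
        (by omega)
      omega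
    refine ⟨((hτ' C hC i hiC).2 fun b hb => not_lt.2 (hCi b hb)).unique ⟨hjC, hCj⟩, Or.inr ?_⟩
    exact fun c hc => hCi c ((h.1.1.sameBlock_iff hC hiC).1 hc)
  · push Not at hmax
    obtain ⟨-, hmin⟩ := (hτ B hB j hjB).2 fun b hb => not_lt.2 (hmax b hb)
    rw [hjk] at hmin
    refine ⟨?_, Or.inl fun b hb => hmin ((hmemB hb).1 hkB)⟩
    by_cases hiN : i.val + 1 < N
    · rw [if_pos hiN] at hk
      have hkj_le : k ≤ j := hmin hjB
      have hij : i < j := by omega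
      have hjC : j ∈ C := by
        refine (h.1.1.sameBlock_iff hC hiC).1 ((h.sameBlock_iff hp hij).2
          fun a b hab hia haj => ?_)
        by_cases haB : a ∈ B
        · have h1 := hmin ((hmemB hab).1 haB)
          have h2 := hmax b ((hmemB hab).1 haB)
          exact ⟨by omega, h2⟩
        have hbB : b ∉ B := fun hb => haB ((hmemB hab).2 hb)
        have haj' : a ≠ j := fun ha => haB (ha ▸ hjB)
        have hak : a ≠ k := fun ha => haB (ha ▸ hkB)
        by_contra hcon
        rcases le_or_gt b i with hbi | hib
        · have := hp.sameBlock_of_lt (show b < k by omega) (show k < a by omega)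
            (show a < j by omega) (hp.1.equivalence.symm hab) hkj
          exact hbB ((hmemB this).2 hkB)
        · have := hp.sameBlock_of_lt (show k < a by omega) (show a < j by omega)
            (show j < b by omega) hkj hab
          exact haB ((hmemB this).1 hkB)
      refine ((hτ' C hC i hiC).1 ⟨j, hjC, hij⟩).unique ⟨⟨hjC, hij⟩, ?_⟩
      rintro c ⟨hc, hic⟩
      by_contra! hlt
      have := (h.sameBlock_iff hp hic).1 ⟨C, hC, hiC, hc⟩ k j hkj (by omega) (by omega)
      omega
    · rw [if_neg hiN] at hk
      have hjC : j ∈ C := by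
        rcases eq_or_lt_of_le (show j ≤ i by omega) with rfl | hji
        · exact hiC
        refine (h.1.1.sameBlock_iff hC hiC).1 (h.1.1.equivalence.symm
          ((h.sameBlock_iff hp hji).2 fun a b hab hja hai => ?_))
        have haB : a ∉ B := fun ha => absurd (hmax a ha) (not_le.2 hja)
        have hbB : b ∉ B := fun hb => haB ((hmemB hab).2 hb)
        have hbj : b ≠ j := fun hb => hbB (hb ▸ hjB)
        have hbk : b ≠ k := fun hb => hbB (hb ▸ hkB)
        by_contra hcon
        have := hp.sameBlock_of_lt (show k < b by omega) (show b < j by omega) hja hkj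
          (hp.1.equivalence.symm hab)
        exact hbB ((hmemB this).1 hkB)
      refine ((hτ' C hC i hiC).2 fun b _ => not_lt.2 (by omega)).unique ⟨hjC, ?_⟩
      intro c hc
      by_contra! hlt
      have := (h.sameBlock_iff hp (show c < i by omega)).1 ⟨C, hC, hc, hiC⟩ j k hjk' hlt
        (by omega)
      omega

end Partition

section TypeB

variable {n : ℕ}

lemma cyclicGap_negMap (a c : Fin (2*n)) :
    cyclicGap (negMap n a) (negMap n c) = cyclicGap a c := by
  have := a.isLt
  have := c.isLt
  unfold cyclicGap
  simp only [Fin.lt_def, negMap_val]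
  split_ifs <;> omega

lemma NCBPart.sameBlock_negMap {P : Set (Set (Fin (2*n)))} (h : NCBPart n P) {x y : Fin (2*n)}
    (hxy : SameBlock P x y) : SameBlock P (negMap n x) (negMap n y) := by
  obtain ⟨B, hB, hx, hy⟩ := hxy
  exact ⟨_, h.2 B hB, Set.mem_image_of_mem _ hx, Set.mem_image_of_mem _ hy⟩

lemma IsIota.inWn {P : Set (Set (Fin (2*n)))} (h : NCBPart n P) {τ : Equiv.Perm (Fin (2*n))}
    (hτ : IsIota (2*n) P τ) : InWn n τ := by
  intro k
  obtain ⟨B, ⟨hB, hk⟩, -⟩ := h.1.1.2 k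
  have hnB := h.2 B hB
  have hnk : negMap n k ∈ negSet n B := Set.mem_image_of_mem _ hk
  obtain ⟨c, hc, hc'⟩ := hτ.mem hnB hnk
  have h1 := hτ.cyclicGap_le hB hk hc
  have h2 := hτ.cyclicGap_le hnB hnk (Set.mem_image_of_mem (negMap n) (hτ.mem hB hk))
  rw [← hc', cyclicGap_negMap, cyclicGap_negMap] at h2
  rw [← hc']
  congr 1
  have h3 := le_antisymm h2 h1
  have := k.isLt
  have := c.isLt
  have := (τ k).isLt
  unfold cyclicGap at h3
  simp only [Fin.lt_def] at h3
  apply Fin.ext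
  split_ifs at h3 <;> omega

lemma NCPart.sameBlock_of_sameBlock_negMap {P : Set (Set (Fin (2*n)))} (h : NCPart P)
    {x y : Fin (2*n)} (hx : SameBlock P x (negMap n x)) (hy : SameBlock P y (negMap n y)) :
    SameBlock P x y := by
  have hE := h.1.equivalence
  have key : ∀ u v : Fin (2*n), u.val < n → v.val < n → SameBlock P u (negMap n u) →
      SameBlock P v (negMap n v) → SameBlock P u v := by
    intro u v hu hv hu' hv'
    have hun := negMap_val u
    have hvn := negMap_val v
    rw [if_pos hu] at hun
    rw [if_pos hv] at hvn
    rcases lt_trichotomy u v with huv | rfl | huv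
    · exact h.sameBlock_of_lt huv (show v < negMap n u by omega)
        (show negMap n u < negMap n v by omega) hu' hv'
    · exact hE.refl _
    · exact hE.symm (h.sameBlock_of_lt huv (show u < negMap n v by omega)
        (show negMap n v < negMap n u by omega) hv' hu')
  have red : ∀ u : Fin (2*n), SameBlock P u (negMap n u) →
      ∃ v : Fin (2*n), v.val < n ∧ SameBlock P u v ∧ SameBlock P v (negMap n v) := by
    intro u hu
    by_cases hun : u.val < n
    · exact ⟨u, hun, hE.refl _, hu⟩
    · refine ⟨negMap n u, ?_, hu, by rw [negMap_negMap]; exact hE.symm hu⟩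
      have := u.isLt
      rw [negMap_val, if_neg hun]
      omega
  obtain ⟨u, hu, hxu, hu'⟩ := red x hx
  obtain ⟨v, hv, hyv, hv'⟩ := red y hy
  exact hE.trans hxu (hE.trans (key u v hu hv hu' hv') (hE.symm hyv))

lemma IsKr.sameBlock_negMap {P Q : Set (Set (Fin (2*n)))} (h : NCBPart n P)
    (hQ : IsKr (2*n) P Q) {x y : Fin (2*n)} (hxy : SameBlock Q x y) :
    SameBlock Q (negMap n x) (negMap n y) := by
  have hE := hQ.1.1.equivalence
  have key : ∀ u v : Fin (2*n), u < v → SameBlock Q u v →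
      SameBlock Q (negMap n u) (negMap n v) := by
    intro u v huv huv'
    have hS := (hQ.sameBlock_iff h.1 huv).1 huv'
    have hS' : ∀ a b, SameBlock P a b →
        (u < negMap n a ∧ negMap n a ≤ v ↔ u < negMap n b ∧ negMap n b ≤ v) := fun a b hab =>
      ⟨fun ha => hS _ _ (h.sameBlock_negMap hab) ha.1 ha.2,
        fun hb => hS _ _ (h.sameBlock_negMap (h.1.1.equivalence.symm hab)) hb.1 hb.2⟩
    have hu := u.isLt
    have hv := v.isLt
    have hun := negMap_val u
    have hvn := negMap_val v
    simp only [Fin.lt_def, Fin.le_def, negMap_val] at hS' huv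
    rcases lt_trichotomy (negMap n u) (negMap n v) with hlt | heq | hlt
    · rw [hQ.sameBlock_iff h.1 hlt]
      intro a b hab ha ha'
      have := hS' a b hab
      have := a.isLt
      have := b.isLt
      simp only [Fin.lt_def, Fin.le_def] at hlt ha ha' ⊢
      rw [hun] at *
      rw [hvn] at *
      split_ifs at * <;> omega
    · rw [heq]; exact hE.refl _
    · refine hE.symm ((hQ.sameBlock_iff h.1 hlt).2 ?_)
      intro a b hab ha ha'
      have := hS' a b hab
      have := a.isLt
      have := b.isLt
      simp only [Fin.lt_def, Fin.le_def] at hlt ha ha' ⊢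
      rw [hun] at *
      rw [hvn] at *
      split_ifs at * <;> omega
  rcases lt_trichotomy x y with hlt | rfl | hlt
  · exact key x y hlt hxy
  · exact hE.refl _
  · exact hE.symm (key y x hlt (hE.symm hxy))

/-- The long product decomposition for a permutation respecting the blocks of a `-`-invariant
non-crossing partition, with blocks counted through a choice `f` of representatives. -/
lemma NCPart.exists_reflections {P : Set (Set (Fin (2*n)))} (h : NCPart P)
    (hneg : ∀ x y, SameBlock P x y → SameBlock P (negMap n x) (negMap n y))
    {τ : Equiv.Perm (Fin (2*n))} (hτ : InWn n τ) (hτP : ∀ x, SameBlock P x (τ x))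
    {f : Fin (2*n) → Fin (2*n)} (hf : ∀ x, SameBlock P x (f x))
    (hf' : ∀ x y, SameBlock P x y → f x = f y) :
    ∃ l : List (Equiv.Perm (Fin (2*n))), (∀ ρ ∈ l, ρ ∈ Rn n) ∧ l.prod = τ ∧
      2 * l.length + (Finset.univ.filter fun x => f x = x).card ≤ 2 * n + 1 := by
  have hE := h.1.equivalence
  have hiff : ∀ x y, f x = f y → SameBlock P x y := fun x y hxy =>
    hE.trans (hf x) (hxy ▸ hE.symm (hf y))
  exact exists_reflections_of_representative hτ (fun x => (hf' _ _ (hf x)).symm)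
    (fun x y hxy => hf' _ _ (hneg _ _ (hiff _ _ hxy)))
    (fun x y hx hy => hf' _ _ (h.sameBlock_of_sameBlock_negMap (hiff _ _ hx) (hiff _ _ hy)))
    (fun x => (hf' _ _ (hτP x)).symm)

end TypeB

end NCPB
open NCPB in
/-- For `π ∈ NC^B(n)` with Kreweras complement `ρ = Kr(π)`:
`ι(π)·ι(Kr(π)) = ω`, `|ι(π)|_B + |ι(Kr(π))|_B = |ω|_B = n`, and consequently
`ι(π) ∈ [ε, ω]`. -/
theorem iota_mul_iota_kr_eq_omega (n : ℕ) (hn : 0 < n)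
    (π ρ : Set (Set (Fin (2*n)))) (hπ : NCBPart n π) (hKr : IsKr (2*n) π ρ)
    (τ τ' : Equiv.Perm (Fin (2*n))) (hτ : IsIota (2*n) π τ) (hτ' : IsIota (2*n) ρ τ') :
    τ * τ' = omegaW n ∧
    (lenB n τ + lenB n τ' = n ∧ lenB n (omegaW n) = n) ∧
    (leB n 1 τ ∧ leB n τ (omegaW n)) := by
  have hP := hπ.1.1
  have hQ := hKr.1.1
  have hsucc : ∀ i, τ' i = τ⁻¹ (omegaW n i) ∧ ((∀ b, SameBlock π (omegaW n i) b →
      omegaW n i ≤ b) ∨ (∀ c, SameBlock ρ i c → c ≤ i)) := fun i =>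
    hKr.iota_apply hπ.1 hτ hτ' (omegaW_val i) (by simp)
  have hmul : τ * τ' = omegaW n := by
    ext1 i
    rw [Equiv.Perm.mul_apply, (hsucc i).1, ← Equiv.Perm.mul_apply, mul_inv_cancel,
      Equiv.Perm.one_apply]
  have hτ'_eq : τ⁻¹ * omegaW n = τ' := by rw [← hmul, inv_mul_cancel_left]
  have hτW := hτ.inWn hπ
  have hτ'W : InWn n τ' := hτ'_eq ▸ hτW.inv.mul inWn_omegaW
  obtain ⟨f, hf, hfmin⟩ := exists_min_representative hP
  obtain ⟨g, hg, hgmax⟩ := exists_max_representative hQ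
  have hf' : ∀ x y, SameBlock π x y → f x = f y := fun x y hxy => le_antisymm
    (hfmin _ _ (hP.equivalence.trans hxy (hf y)))
    (hfmin _ _ (hP.equivalence.trans (hP.equivalence.symm hxy) (hf x)))
  have hg' : ∀ x y, SameBlock ρ x y → g x = g y := fun x y hxy => le_antisymm
    (hgmax _ _ (hQ.equivalence.trans (hQ.equivalence.symm hxy) (hg x)))
    (hgmax _ _ (hQ.equivalence.trans hxy (hg y)))
  obtain ⟨l, hl, hlτ, hlen⟩ := hπ.1.exists_reflections (fun _ _ => hπ.sameBlock_negMap) hτW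
    (hτ.sameBlock hP) hf hf'
  obtain ⟨l', hl', hlτ', hlen'⟩ := hKr.1.exists_reflections
    (fun _ _ => hKr.sameBlock_negMap hπ) hτ'W (hτ'.sameBlock hQ) hg hg'
  have hfmin' : ∀ x, (∀ b, SameBlock π x b → x ≤ b) → f x = x := fun x hx =>
    le_antisymm (hfmin x x (hP.equivalence.refl x)) (hx _ (hf x))
  have hgmax' : ∀ x, (∀ b, SameBlock ρ x b → b ≤ x) → g x = x := fun x hx =>
    le_antisymm (hx _ (hg x)) (hgmax x x (hQ.equivalence.refl x))
  have hcount : 2 * n + 1 ≤ (Finset.univ.filter fun x => f x = x).card +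
      (Finset.univ.filter fun x => g x = x).card := by
    have hA : (Finset.univ.filter fun x => f x = x).card =
        (Finset.univ.filter fun i => f (omegaW n i) = omegaW n i).card := by
      symm
      apply Finset.card_bijective (omegaW n) (omegaW n).bijective
      simp
    rw [hA, ← Finset.card_union_add_card_inter]
    have hunion : (Finset.univ.filter fun i => f (omegaW n i) = omegaW n i) ∪
        (Finset.univ.filter fun x => g x = x) = Finset.univ := by
      ext i
      simp only [Finset.mem_union, Finset.mem_filter, Finset.mem_univ, true_and, iff_true]
      exact (hsucc i).2.imp (hfmin' _) (hgmax' _)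
    rw [hunion, Finset.card_univ, Fintype.card_fin]
    have hlast : (omegaW n ⟨2*n - 1, by omega⟩).val = 0 := by
      rw [omegaW_val, if_neg (by simp only; omega)]
    refine Nat.add_le_add_left (Finset.card_pos.2 ⟨⟨2*n - 1, by omega⟩, ?_⟩) _
    simp only [Finset.mem_inter, Finset.mem_filter, Finset.mem_univ, true_and]
    exact ⟨hfmin' _ fun b _ => by rw [Fin.le_def, hlast]; exact Nat.zero_le _,
      hgmax' _ fun b _ => by rw [Fin.le_def]; have := b.isLt; simp only; omega⟩
  have hleτ := hlτ ▸ lenB_le hl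
  have hleτ' := hlτ' ▸ lenB_le hl'
  obtain ⟨m, hm, hmlen, hmprod⟩ := exists_length_eq_lenB hl
  obtain ⟨m', hm', hmlen', hmprod'⟩ := exists_length_eq_lenB hl'
  rw [hlτ] at hmlen hmprod
  rw [hlτ'] at hmlen' hmprod'
  have happend : ∀ r ∈ m ++ m', r ∈ Rn n := fun r hr =>
    (List.mem_append.1 hr).elim (hm r) (hm' r)
  have hprod : (m ++ m').prod = omegaW n := by rw [List.prod_append, hmprod, hmprod', hmul]
  have hlower := le_length_of_prod_eq_omegaW happend hprod
  have hω_le := hprod ▸ lenB_le happend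
  rw [List.length_append] at hlower hω_le
  obtain ⟨w, hw, hwlen, hwprod⟩ := exists_length_eq_lenB happend
  rw [hprod] at hwlen hwprod
  have hω_ge := le_length_of_prod_eq_omegaW hw hwprod
  have hone : lenB n 1 = 0 := by
    simpa using lenB_le (n := n) (l := []) (by simp)
  have hsum : lenB n τ + lenB n τ' = n := by omega
  have hω : lenB n (omegaW n) = n := by omega
  refine ⟨hmul, ⟨hsum, hω⟩, ?_, ?_⟩
  · rw [leB, hone, inv_one, one_mul, zero_add]
  · rw [leB, hτ'_eq, hsum, hω]
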